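/- For all real numbers a, b ≥ 0 with a ≠ b, one has (a·log a − b·log b)/(a − b) < (a + b)/2, with the convention 0·log 0 = 0. -/

import Mathlib

lemma aux_strictMonoOn : StrictMonoOn (fun x : ℝ => x ^ 2 / 2 - x * Real.log x) (Set.Ici 0) := by
  have hc : Continuous (fun x : ℝ => x ^ 2 / 2 - x * Real.log x) :=
    ((continuous_pow 2).div_const 2).sub Real.continuous_mul_log
  have hd : ∀ x : ℝ, 0 < x → x ≠ 1 → 0 < deriv (fun x : ℝ => x ^ 2 / 2 - x * Real.log x) x := by
    intro x hx h1
    have h : HasDerivAt (fun x : ℝ => x ^ 2 / 2 - x * Real.log x) (2 * x / 2 - (Real.log x + 1)) x := by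
      have h2 := (hasDerivAt_pow 2 x).div_const 2
      have h3 := Real.hasDerivAt_mul_log hx.ne'
      simpa using h2.fun_sub h3
    rw [h.deriv]
    linarith [Real.log_lt_sub_one_of_pos hx h1]
  have hA : StrictMonoOn (fun x : ℝ => x ^ 2 / 2 - x * Real.log x) (Set.Icc 0 1) := by
    apply strictMonoOn_of_deriv_pos (convex_Icc 0 1) hc.continuousOn
    intro x hx
    rw [interior_Icc] at hx
    exact hd x hx.1 hx.2.ne
  have hB : StrictMonoOn (fun x : ℝ => x ^ 2 / 2 - x * Real.log x) (Set.Ici 1) := by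
    apply strictMonoOn_of_deriv_pos (convex_Ici 1) hc.continuousOn
    intro x hx
    rw [interior_Ici] at hx
    have hx' : (1 : ℝ) < x := hx
    exact hd x (by linarith) hx'.ne'
  have := hA.union hB (isGreatest_Icc zero_le_one) isLeast_Ici
  rwa [Set.Icc_union_Ici_eq_Ici zero_le_one] at this

/-- The secant estimate: for `a, b ≥ 0` with `a ≠ b`,
`(a·log a − b·log b)/(a − b) < (a + b)/2`
(with the convention `0·log 0 = 0`, automatic since `Real.log 0 = 0`). -/
theorem secant_log_lt_avg (a b : ℝ) (ha : 0 ≤ a) (hb : 0 ≤ b) (hab : a ≠ b) :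
    (a * Real.log a - b * Real.log b) / (a - b) < (a + b) / 2 := by
  rcases lt_or_gt_of_ne hab with h | h
  · have := aux_strictMonoOn (Set.mem_Ici.2 ha) (Set.mem_Ici.2 hb) h
    simp only at this
    rw [div_lt_iff_of_neg (by linarith)]
    nlinarith
  · have := aux_strictMonoOn (Set.mem_Ici.2 hb) (Set.mem_Ici.2 ha) h
    simp only at this
    rw [div_lt_iff₀ (by linarith)]
    nlinarith
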